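/- Let G be a weak near-triangulation and let u be a problematic internal vertex of G. Let T be the set of all u-bad vertices of G, and suppose T is nonempty. Then G−({u} ∪ T) is a weak near-triangulation. -/

import Mathlib

open Set

/-- A plane graph: a finite simple graph whose vertices are points of the plane,
together with a plane embedding in which every edge is drawn as an arc (the range of an
injective path) joining its endpoints, two arcs meet only in common endpoints, and
no vertex lies on an arc other than at its endpoints. -/
structure PlaneGraph where
  verts : Set (ℝ × ℝ)
  finite_verts : verts.Finite
  Adj : (ℝ × ℝ) → (ℝ × ℝ) → Prop
  adj_symm : ∀ u v, Adj u v → Adj v u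
  adj_irrefl : ∀ v, ¬ Adj v v
  adj_mem : ∀ u v, Adj u v → u ∈ verts
  arc : (ℝ × ℝ) → (ℝ × ℝ) → Set (ℝ × ℝ)
  arc_symm : ∀ u v, arc u v = arc v u
  arc_path : ∀ u v, Adj u v → ∃ γ : Path u v, Function.Injective ⇑γ ∧ arc u v = Set.range ⇑γ
  arc_verts : ∀ u v, Adj u v → verts ∩ arc u v ⊆ {u, v}
  arc_inter : ∀ u v u' v', Adj u v → Adj u' v' → ({u, v} : Set (ℝ × ℝ)) ≠ {u', v'} →
    arc u v ∩ arc u' v' ⊆ ({u, v} : Set (ℝ × ℝ)) ∩ {u', v'}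

namespace PlaneGraph

/-- The plane subgraph induced on a set of vertices, with the inherited embedding. -/
def induce (G : PlaneGraph) (S : Set (ℝ × ℝ)) : PlaneGraph where
  verts := G.verts ∩ S
  finite_verts := G.finite_verts.subset inter_subset_left
  Adj u v := G.Adj u v ∧ u ∈ S ∧ v ∈ S
  adj_symm _ _ h := ⟨G.adj_symm _ _ h.1, h.2.2, h.2.1⟩
  adj_irrefl v h := G.adj_irrefl v h.1
  adj_mem _ _ h := ⟨G.adj_mem _ _ h.1, h.2.1⟩
  arc := G.arc
  arc_symm := G.arc_symm
  arc_path _ _ h := G.arc_path _ _ h.1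
  arc_verts _ _ h := fun _ hx => G.arc_verts _ _ h.1 ⟨hx.1.1, hx.2⟩
  arc_inter _ _ _ _ h h' hne := G.arc_inter _ _ _ _ h.1 h'.1 hne

/-- Deleting a set of vertices (together with all incident edges),
keeping the inherited embedding. -/
def delete (G : PlaneGraph) (X : Set (ℝ × ℝ)) : PlaneGraph := G.induce Xᶜ

/-- Deleting a single vertex. -/
def erase (G : PlaneGraph) (x : ℝ × ℝ) : PlaneGraph := G.delete {x}

/-- The point set of the plane drawing of `G`. -/
def drawing (G : PlaneGraph) : Set (ℝ × ℝ) :=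
  G.verts ∪ ⋃ (u) (v) (_ : G.Adj u v), G.arc u v

/-- The faces of `G`: connected components of the complement of the drawing. -/
def IsFace (G : PlaneGraph) (F : Set (ℝ × ℝ)) : Prop :=
  ∃ x, x ∉ G.drawing ∧ F = connectedComponentIn G.drawingᶜ x

/-- A vertex is external if it is incident to (i.e. lies on the boundary of)
an unbounded face. -/
def ExternalVertex (G : PlaneGraph) (v : ℝ × ℝ) : Prop :=
  v ∈ G.verts ∧ ∃ F, G.IsFace F ∧ ¬ Bornology.IsBounded F ∧ v ∈ closure F

/-- A triangle (cycle on three vertices) of `G`. -/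
def IsTriangle (G : PlaneGraph) (a b c : ℝ × ℝ) : Prop :=
  a ≠ b ∧ a ≠ c ∧ b ≠ c ∧ G.Adj a b ∧ G.Adj b c ∧ G.Adj a c

/-- `v` is contained in a triangle of `G`. -/
def InTriangle (G : PlaneGraph) (v : ℝ × ℝ) : Prop := ∃ b c, G.IsTriangle v b c

/-- The drawing of the closed curve formed by a triangle on `a`, `b`, `c`. -/
def triDrawing (G : PlaneGraph) (a b c : ℝ × ℝ) : Set (ℝ × ℝ) :=
  G.arc a b ∪ G.arc b c ∪ G.arc a c

/-- A face is triangular if its boundary is the drawing of a triangle of `G`. -/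
def IsTriangularFace (G : PlaneGraph) (F : Set (ℝ × ℝ)) : Prop :=
  ∃ a b c, G.IsTriangle a b c ∧ frontier F = G.triDrawing a b c

/-- The interior region of the closed curve drawn by a triangle: the union of the
bounded connected components of the complement of its drawing. -/
def triangleInterior (G : PlaneGraph) (a b c : ℝ × ℝ) : Set (ℝ × ℝ) :=
  {x | x ∉ G.triDrawing a b c ∧
    Bornology.IsBounded (connectedComponentIn (G.triDrawing a b c)ᶜ x)}

/-- A facial triangle: a triangle whose interior region is a face of `G`. -/
def IsFacialTriangle (G : PlaneGraph) (a b c : ℝ × ℝ) : Prop :=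
  G.IsTriangle a b c ∧ G.IsFace (G.triangleInterior a b c)

/-- A weak near-triangulation: every bounded face is triangular and every vertex
is contained in a triangle. -/
def IsWNT (G : PlaneGraph) : Prop :=
  (∀ F, G.IsFace F → Bornology.IsBounded F → G.IsTriangularFace F) ∧
  ∀ v ∈ G.verts, G.InTriangle v

/-- Reachability by walks in `G`. -/
def Reachable (G : PlaneGraph) (u v : ℝ × ℝ) : Prop := Relation.ReflTransGen G.Adj u v

/-- Connectedness of `G`. -/
def Connected (G : PlaneGraph) : Prop :=
  G.verts.Nonempty ∧ ∀ u ∈ G.verts, ∀ v ∈ G.verts, G.Reachable u v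

/-- A cutvertex: a vertex whose deletion separates two other vertices. -/
def IsCutvertex (G : PlaneGraph) (v : ℝ × ℝ) : Prop :=
  v ∈ G.verts ∧ ∃ a b, a ∈ G.verts ∧ b ∈ G.verts ∧ a ≠ v ∧ b ≠ v ∧
    G.Reachable a b ∧ ¬ (G.erase v).Reachable a b

/-- 2-connectivity: connected, on at least three vertices, with no cutvertex. -/
def TwoConnected (G : PlaneGraph) : Prop :=
  G.Connected ∧ 3 ≤ G.verts.ncard ∧ ∀ v, ¬ G.IsCutvertex v

/-- A near-triangulation: a 2-connected plane graph all of whose bounded faces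
are triangular. -/
def IsNearTriangulation (G : PlaneGraph) : Prop :=
  G.TwoConnected ∧ ∀ F, G.IsFace F → Bornology.IsBounded F → G.IsTriangularFace F

/-- A plane triangulation: a connected plane graph all of whose faces (including
the unbounded one) are triangular. -/
def IsTriangulation (G : PlaneGraph) : Prop :=
  G.Connected ∧ ∀ F, G.IsFace F → G.IsTriangularFace F

/-- A block of `G`, given by its vertex set `B`: a maximal set of vertices inducing
a connected subgraph without a cutvertex. -/
def IsBlock (G : PlaneGraph) (B : Set (ℝ × ℝ)) : Prop :=
  B ⊆ G.verts ∧ (G.induce B).Connected ∧ (∀ v, ¬ (G.induce B).IsCutvertex v) ∧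
  ∀ B', B ⊆ B' → B' ⊆ G.verts → (G.induce B').Connected →
    (∀ v, ¬ (G.induce B').IsCutvertex v) → B' = B

/-- A plane graph is outerplanar if all of its vertices are incident to the
unbounded face. -/
def IsOuterplanar (G : PlaneGraph) : Prop := ∀ v ∈ G.verts, G.ExternalVertex v

/-- A dominating set of `G`. -/
def IsDominatingSet (G : PlaneGraph) (D : Set (ℝ × ℝ)) : Prop :=
  D ⊆ G.verts ∧ ∀ v ∈ G.verts, v ∉ D → ∃ d ∈ D, G.Adj v d

/-- The domination number of `G`. -/
noncomputable def dominationNumber (G : PlaneGraph) : ℕ :=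
  sInf {n | ∃ D, G.IsDominatingSet D ∧ D.ncard = n}

/-- `u` is problematic in `G` if `G − u` is not a weak near-triangulation. -/
def Problematic (G : PlaneGraph) (u : ℝ × ℝ) : Prop := ¬ (G.erase u).IsWNT

/-- `x` is a `u`-bad vertex in `G`: a vertex of `G − u` not contained in a triangle
of `G − u`. -/
def IsBadFor (G : PlaneGraph) (u x : ℝ × ℝ) : Prop :=
  x ∈ G.verts ∧ x ≠ u ∧ ¬ (G.erase u).InTriangle x

end PlaneGraph

section PlaneTopology

open Metric Topology

theorem isPreconnected_setOf_lt_norm {E : Type*} [NormedAddCommGroup E] [NormedSpace ℝ E]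
    (h : 1 < Module.rank ℝ E) {R : ℝ} (hR : 0 ≤ R) : IsPreconnected {z : E | R < ‖z‖} := by
  have hc := (isConnected_compl_singleton_of_one_lt_rank h (0 : E)).isPreconnected
  have hf : ContinuousOn (fun y : E => (1 + R * ‖y‖⁻¹) • y) {0}ᶜ := by
    intro y hy
    have : ‖y‖ ≠ 0 := by simpa using hy
    exact ((continuousAt_const.add (continuousAt_const.mul
      (continuousAt_id.norm.inv₀ this))).smul continuousAt_id).continuousWithinAt
  convert hc.image _ hf using 1
  ext z
  simp only [mem_ofPred_eq, mem_image, mem_compl_iff, mem_singleton_iff]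
  constructor
  · intro hz
    have hz0 : 0 < ‖z‖ := hR.trans_lt hz
    have h1 : 0 < 1 - R / ‖z‖ := by rw [sub_pos, div_lt_one hz0]; exact hz
    refine ⟨(1 - R / ‖z‖) • z, ?_, ?_⟩
    · rw [smul_eq_zero, not_or]
      exact ⟨h1.ne', norm_pos_iff.1 hz0⟩
    · rw [smul_smul, norm_smul, Real.norm_of_nonneg h1.le]
      have : (1 + R * ((1 - R / ‖z‖) * ‖z‖)⁻¹) * (1 - R / ‖z‖) = 1 := by
        have h2 : ‖z‖ - R ≠ 0 := (sub_pos.2 hz).ne'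
        have h3 : (1 - R / ‖z‖) * ‖z‖ = ‖z‖ - R := by field_simp
        rw [h3]; field_simp; ring
      rw [this, one_smul]
  · rintro ⟨y, hy, rfl⟩
    have hy0 : 0 < ‖y‖ := norm_pos_iff.2 hy
    rw [norm_smul, Real.norm_of_nonneg (by positivity)]
    have : (1 + R * ‖y‖⁻¹) * ‖y‖ = ‖y‖ + R := by field_simp
    linarith

/-- In dimension at least two, a bounded set misses a connected set with bounded complement. -/
theorem Bornology.IsBounded.exists_isPreconnected_compl {E : Type*} [NormedAddCommGroup E]
    [NormedSpace ℝ E] (h : 1 < Module.rank ℝ E) {S : Set E} (hS : Bornology.IsBounded S) :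
    ∃ W ⊆ Sᶜ, IsPreconnected W ∧ Bornology.IsBounded Wᶜ := by
  obtain ⟨R, hR0, hR⟩ := hS.subset_closedBall_lt 0 (0 : E)
  refine ⟨{z : E | R < ‖z‖}, ?_, isPreconnected_setOf_lt_norm h hR0.le, ?_⟩
  · intro z hz hzS
    have := hR hzS
    simp at this hz
    linarith
  · refine (isBounded_closedBall (x := (0 : E)) (r := R)).subset ?_
    intro z hz
    simpa using hz

theorem inter_nonempty_of_isBounded_compl {E : Type*} [Bornology E] {V W : Set E}
    (hV : ¬ Bornology.IsBounded V) (hW : Bornology.IsBounded Wᶜ) : (V ∩ W).Nonempty := by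
  by_contra h
  exact hV (hW.subset fun z hz hzW => h ⟨z, hz, hzW⟩)

/-- In dimension at least two, the complement of a bounded set has at most one unbounded
component. -/
theorem connectedComponentIn_eq_of_not_isBounded {E : Type*} [NormedAddCommGroup E]
    [NormedSpace ℝ E] (h : 1 < Module.rank ℝ E) {S : Set E} (hS : Bornology.IsBounded S) {p q : E}
    (hp : ¬ Bornology.IsBounded (connectedComponentIn Sᶜ p))
    (hq : ¬ Bornology.IsBounded (connectedComponentIn Sᶜ q)) :
    connectedComponentIn Sᶜ p = connectedComponentIn Sᶜ q := by
  obtain ⟨W, hWS, hW, hWb⟩ := hS.exists_isPreconnected_compl h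
  obtain ⟨a, hap, haW⟩ := inter_nonempty_of_isBounded_compl hp hWb
  obtain ⟨b, hbq, hbW⟩ := inter_nonempty_of_isBounded_compl hq hWb
  rw [connectedComponentIn_eq hap, connectedComponentIn_eq hbq]
  exact connectedComponentIn_eq (hW.subset_connectedComponentIn haW hWS hbW)

theorem exists_not_isBounded_connectedComponentIn {E : Type*} [NormedAddCommGroup E]
    [NormedSpace ℝ E] (h : 1 < Module.rank ℝ E) {S : Set E} (hS : Bornology.IsBounded S) :
    ∃ q ∈ Sᶜ, ¬ Bornology.IsBounded (connectedComponentIn Sᶜ q) := by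
  obtain ⟨W, hWS, hW, hWb⟩ := hS.exists_isPreconnected_compl h
  have : Nontrivial E := rank_pos_iff_nontrivial.1 (zero_lt_one.trans h)
  have hu : ¬ Bornology.IsBounded (univ : Set E) := NormedSpace.unbounded_univ ℝ E
  have hWu : ¬ Bornology.IsBounded W := fun hb => hu (by simpa using hb.union hWb)
  obtain ⟨q, hq⟩ : W.Nonempty := by
    by_contra he
    rw [not_nonempty_iff_eq_empty] at he
    exact hWu (he ▸ Bornology.isBounded_empty)
  exact ⟨q, hWS hq, fun hb => hWu (hb.subset (hW.subset_connectedComponentIn hq hWS))⟩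

section Components

variable {X : Type*} [TopologicalSpace X]

theorem IsPreconnected.inter_frontier_nonempty' {s V : Set X} (hs : IsPreconnected s)
    (h1 : (s ∩ V).Nonempty) (h2 : (s ∩ Vᶜ).Nonempty) : (s ∩ frontier V).Nonempty := by
  by_contra h
  have hd : Disjoint s (frontier V) := by
    rw [disjoint_iff_inter_eq_empty, ← not_nonempty_iff_eq_empty]; exact h
  obtain ⟨z, hz, hz1, hz2⟩ := hs (interior V) (closure V)ᶜ isOpen_interior
    isClosed_closure.isOpen_compl (fun z hz => by
      by_cases hzc : z ∈ closure V
      · left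
        by_contra hzi
        exact hd.le_bot ⟨hz, hzc, hzi⟩
      · exact Or.inr hzc)
    (by
      obtain ⟨z, hz, hzV⟩ := h1
      refine ⟨z, hz, ?_⟩
      by_contra hzi
      exact hd.le_bot ⟨hz, subset_closure hzV, hzi⟩)
    (by
      obtain ⟨z, hz, hzV⟩ := h2
      refine ⟨z, hz, fun hzc => ?_⟩
      exact hd.le_bot ⟨hz, hzc, fun hzi => hzV (interior_subset hzi)⟩)
  exact hz2 (subset_closure (interior_subset hz1))

/-- A preconnected set that meets `V` and misses its frontier is contained in `V`. -/
theorem IsPreconnected.subset_of_disjoint_frontier {s V : Set X} (hs : IsPreconnected s)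
    (h1 : (s ∩ V).Nonempty) (h : Disjoint s (frontier V)) : s ⊆ V := by
  by_contra h2
  obtain ⟨z, hz, hzV⟩ := not_subset.1 h2
  obtain ⟨w, hw, hwV⟩ := hs.inter_frontier_nonempty' h1 ⟨z, hz, hzV⟩
  exact h.le_bot ⟨hw, hwV⟩

theorem connectedComponentIn_compl_subset {S V : Set X} {p : X} (hp : p ∈ V)
    (hV : frontier V ⊆ S) : connectedComponentIn Sᶜ p ⊆ V := by
  by_cases hpS : p ∈ Sᶜ
  · refine isPreconnected_connectedComponentIn.subset_of_disjoint_frontier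
      ⟨p, mem_connectedComponentIn hpS, hp⟩ ?_
    exact (disjoint_compl_left_iff_subset.2 hV).mono_left (connectedComponentIn_subset _ _)
  · rw [connectedComponentIn_eq_empty hpS]; exact empty_subset _

theorem frontier_connectedComponentIn_compl_subset [LocallyConnectedSpace X] {S : Set X}
    (hS : IsClosed S) (p : X) : frontier (connectedComponentIn Sᶜ p) ⊆ S := by
  intro z hz
  by_contra hzS
  have ho : IsOpen (connectedComponentIn Sᶜ z) := hS.isOpen_compl.connectedComponentIn
  have hop : IsOpen (connectedComponentIn Sᶜ p) := hS.isOpen_compl.connectedComponentIn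
  obtain ⟨w, hwz, hwp⟩ := mem_closure_iff.1 hz.1 _ ho (mem_connectedComponentIn hzS)
  have := (connectedComponentIn_eq hwz).trans (connectedComponentIn_eq hwp).symm
  rw [hop.frontier_eq] at hz
  exact hz.2 (this ▸ mem_connectedComponentIn hzS)

/-- Two preconnected sets off `S` whose closures share a point off `S` lie in one component. -/
theorem mem_connectedComponentIn_of_closure {S U V : Set X} {p q z : X} (hU : IsPreconnected U)
    (hV : IsPreconnected V) (hUS : Disjoint U S) (hVS : Disjoint V S) (hp : p ∈ U) (hq : q ∈ V)
    (hzU : z ∈ closure U) (hzV : z ∈ closure V) (hz : z ∉ S) :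
    q ∈ connectedComponentIn Sᶜ p := by
  have hU' : IsPreconnected (insert z U) := hU.subset_closure (subset_insert _ _)
    (insert_subset hzU subset_closure)
  have hV' : IsPreconnected (insert z V) := hV.subset_closure (subset_insert _ _)
    (insert_subset hzV subset_closure)
  have := hU'.union z (mem_insert _ _) (mem_insert _ _) hV'
  refine this.subset_connectedComponentIn (Or.inl (Or.inr hp)) ?_ (Or.inr (Or.inr hq))
  rw [union_subset_iff, insert_subset_iff, insert_subset_iff]
  exact ⟨⟨hz, hUS.subset_compl_right⟩, ⟨hz, hVS.subset_compl_right⟩⟩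

end Components

section Logarithm

open Complex

/-- `f` has a continuous logarithm on `K`. -/
def HasLogOn (f : ℂ → ℂ) (K : Set ℂ) : Prop :=
  ∃ g : ℂ → ℂ, ContinuousOn g K ∧ ∀ z ∈ K, exp (g z) = f z

theorem not_hasLogOn_sphere (p : ℂ) {R : ℝ} (hR : 0 < R) :
    ¬ HasLogOn (fun z => z - p) (sphere p R) := by
  rintro ⟨g, hg, hgz⟩
  let e : ℝ → ℂ := fun t => p + R * exp (t * I)
  have he : Continuous e := by fun_prop
  have hes : ∀ t, e t ∈ sphere p R := fun t => by
    simp [e, Complex.norm_exp_ofReal_mul_I, hR.le]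
  have hR' : (R : ℂ) ≠ 0 := by exact_mod_cast hR.ne'
  let h : ℝ → ℂ := fun t => (g (e t) - t * I - log R) / (2 * Real.pi * I)
  have hh : Continuous h := by
    have : Continuous fun t => g (e t) := hg.comp_continuous he hes
    exact ((this.sub (by fun_prop)).sub continuous_const).div_const _
  have hZ : ∀ t, ∃ n : ℤ, h t = n := fun t => by
    have h1 : exp (g (e t) - t * I - log R) = 1 := by
      rw [exp_sub, exp_sub, hgz _ (hes t), exp_log hR']
      simp only [e, add_sub_cancel_left]
      field_simp [exp_ne_zero]
    obtain ⟨n, hn⟩ := exp_eq_one_iff.1 h1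
    refine ⟨n, ?_⟩
    simp only [h, hn]
    field_simp [two_pi_I_ne_zero, Real.pi_ne_zero]
  choose n hn using hZ
  have hn' : Continuous n := by
    have : Continuous fun t => ((n t : ℤ) : ℝ) := by
      have : (fun t => ((n t : ℤ) : ℝ)) = fun t => (h t).re := by
        ext t; rw [hn t]; simp
      rw [this]; fun_prop
    exact Int.isClosedEmbedding_coe_real.isEmbedding.continuous_iff.2 this
  have hc : n 0 = n (2 * Real.pi) := PreconnectedSpace.constant inferInstance hn'
  have hc' : h 0 = h (2 * Real.pi) := by rw [hn, hn, hc]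
  have h0 : e (2 * Real.pi) = e 0 := by simp [e]
  simp only [h, h0] at hc'
  have h2 : (2 * Real.pi * I : ℂ) ≠ 0 := two_pi_I_ne_zero
  rw [div_left_inj' h2] at hc'
  push_cast at hc'
  apply h2
  linear_combination hc'

theorem hasLogOn_univ {f : ℂ → ℂ} (hf : Continuous f) (h0 : ∀ z, f z ≠ 0) : HasLogOn f univ := by
  obtain ⟨F, ⟨-, hF⟩, -⟩ := isCoveringMapOn_exp.existsUnique_continuousMap_lifts
    (A := ℂ) ⟨f, hf⟩ (a₀ := 0) (e₀ := log (f 0)) (exp_log (h0 0)) (fun z => h0 z)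
  exact ⟨F, F.continuous.continuousOn, fun z _ => congr_fun hF z⟩

theorem HasLogOn.mul {f₁ f₂ : ℂ → ℂ} {K : Set ℂ} (h₁ : HasLogOn f₁ K) (h₂ : HasLogOn f₂ K) :
    HasLogOn (fun z => f₁ z * f₂ z) K := by
  obtain ⟨g₁, hc₁, h₁⟩ := h₁
  obtain ⟨g₂, hc₂, h₂⟩ := h₂
  exact ⟨fun z => g₁ z + g₂ z, hc₁.add hc₂, fun z hz => by rw [exp_add, h₁ z hz, h₂ z hz]⟩

theorem HasLogOn.inv {f : ℂ → ℂ} {K : Set ℂ} (h : HasLogOn f K) :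
    HasLogOn (fun z => (f z)⁻¹) K := by
  obtain ⟨g, hc, h⟩ := h
  exact ⟨fun z => -g z, hc.neg, fun z hz => by rw [exp_neg, h z hz]⟩

theorem HasLogOn.congr {f₁ f₂ : ℂ → ℂ} {K : Set ℂ} (h : HasLogOn f₁ K)
    (he : ∀ z ∈ K, f₁ z = f₂ z) : HasLogOn f₂ K := by
  obtain ⟨g, hc, h⟩ := h
  exact ⟨g, hc, fun z hz => (h z hz).trans (he z hz)⟩

theorem HasLogOn.mono {f : ℂ → ℂ} {K L : Set ℂ} (h : HasLogOn f K) (hL : L ⊆ K) :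
    HasLogOn f L := by
  obtain ⟨g, hc, h⟩ := h
  exact ⟨g, hc.mono hL, fun z hz => h z (hL hz)⟩

theorem hasLogOn_div_of_ball_subset {K : Set ℂ} {w w' : ℂ} {ε : ℝ} (h : ball w ε ⊆ Kᶜ)
    (hw' : w' ∈ ball w ε) : HasLogOn (fun z => (z - w') / (z - w)) K := by
  have hne : ∀ z ∈ K, z - w ≠ 0 := fun z hz h0 =>
    h (mem_ball_self (pos_of_mem_ball hw')) (sub_eq_zero.1 h0 ▸ hz)
  have hs : ∀ z ∈ K, (z - w') / (z - w) ∈ slitPlane := fun z hz => by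
    apply ball_one_subset_slitPlane
    have h1 : (z - w') / (z - w) - 1 = (w - w') / (z - w) := by
      field_simp [hne z hz]; ring
    have h2 : ε ≤ ‖z - w‖ := by
      by_contra hlt
      exact h (mem_ball_iff_norm.2 (not_le.1 hlt)) hz
    rw [mem_ball_iff_norm, h1, norm_div, div_lt_one (norm_pos_iff.2 (hne z hz)), norm_sub_rev]
    exact (mem_ball_iff_norm.1 hw').trans_le h2
  refine ⟨fun z => log ((z - w') / (z - w)), ?_, fun z hz => exp_log (slitPlane_ne_zero (hs z hz))⟩
  refine ContinuousOn.clog ?_ hs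
  exact ContinuousOn.div (by fun_prop) (by fun_prop) hne

theorem hasLogOn_div_of_mem_connectedComponentIn {K : Set ℂ} (hK : IsClosed K) {p q : ℂ}
    (h : q ∈ connectedComponentIn Kᶜ p) : HasLogOn (fun z => (z - p) / (z - q)) K := by
  have hp : p ∈ Kᶜ := connectedComponentIn_nonempty_iff.1 ⟨q, h⟩
  have hne : ∀ w ∈ Kᶜ, ∀ z ∈ K, z - w ≠ 0 := fun w hw z hz h0 => hw (sub_eq_zero.1 h0 ▸ hz)
  have key : ∀ w ∈ Kᶜ, ∃ ε > 0, ∀ w' ∈ ball w ε, w' ∈ Kᶜ ∧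
      HasLogOn (fun z => (z - w') / (z - w)) K := fun w hw => by
    obtain ⟨ε, hε, hb⟩ := Metric.isOpen_iff.1 hK.isOpen_compl w hw
    exact ⟨ε, hε, fun w' hw' => ⟨hb hw', hasLogOn_div_of_ball_subset hb hw'⟩⟩
  let u : Set ℂ := {w | w ∈ Kᶜ ∧ HasLogOn (fun z => (z - p) / (z - w)) K}
  have hu : IsOpen u := by
    refine Metric.isOpen_iff.2 fun w hw => ?_
    obtain ⟨ε, hε, hb⟩ := key w hw.1
    refine ⟨ε, hε, fun w' hw' => ⟨(hb w' hw').1, ?_⟩⟩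
    refine (hw.2.mul (hb w' hw').2.inv).congr fun z hz => ?_
    have h1 := hne w hw.1 z hz
    have h2 := hne w' (hb w' hw').1 z hz
    field_simp
  refine (isPreconnected_connectedComponentIn.subset_of_closure_inter_subset hu
    ⟨p, mem_connectedComponentIn hp, hp, ?_⟩ ?_ h).2
  · exact ⟨fun _ => 0, continuousOn_const, fun z hz => by
      simp only [exp_zero, div_self (hne p hp z hz)]⟩
  · rintro w ⟨hwu, hwc⟩
    have hw := connectedComponentIn_subset _ _ hwc
    obtain ⟨ε, hε, hb⟩ := key w hw
    obtain ⟨w', hw', hd⟩ := Metric.mem_closure_iff.1 hwu ε hε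
    have hw'b := hb w' (by rwa [mem_ball, dist_comm])
    refine ⟨hw, (hw'.2.mul hw'b.2).congr fun z hz => ?_⟩
    have h1 := hne w hw z hz
    have h2 := hne w' hw'.1 z hz
    field_simp

theorem mem_connectedComponentIn_of_isBounded {K : Set ℂ} (hK : IsClosed K) {p q : ℂ}
    (hp : p ∈ Kᶜ) (hb : Bornology.IsBounded (connectedComponentIn Kᶜ p))
    (h : HasLogOn (fun z => (z - p) / (z - q)) K) : q ∈ connectedComponentIn Kᶜ p := by
  classical
  by_contra hq'
  obtain ⟨g, hg, hgz⟩ := h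
  set U := connectedComponentIn Kᶜ p with hU
  have hpU : p ∈ U := mem_connectedComponentIn hp
  obtain ⟨G, hG⟩ := ContinuousMap.exists_restrict_eq hK
    ⟨K.domRestrict g, continuousOn_iff_continuous_domRestrict.1 hg⟩
  have hGK : ∀ z ∈ K, G z = g z := fun z hz => DFunLike.congr_fun hG ⟨z, hz⟩
  let φ : ℂ → ℂ := U.piecewise (fun z => exp (G z) * (z - q)) (fun z => z - p)
  have hφ : Continuous φ := by
    refine Continuous.piecewise (fun z hz => ?_) (by fun_prop) (by fun_prop)
    have hzK := frontier_connectedComponentIn_compl_subset hK p hz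
    have hzp : z - p ≠ 0 := fun h0 => hp (sub_eq_zero.1 h0 ▸ hzK)
    have h1 := hgz z hzK
    rw [hGK z hzK, h1]
    have hzq : z - q ≠ 0 := fun h0 => exp_ne_zero (g z) (by rw [h1]; simp only [h0, div_zero])
    field_simp
  have hφ0 : ∀ z, φ z ≠ 0 := fun z => by
    by_cases hz : z ∈ U
    · simp only [φ, piecewise_eq_of_mem _ _ _ hz]
      exact mul_ne_zero (exp_ne_zero _) fun h0 => hq' (sub_eq_zero.1 h0 ▸ hz)
    · simp only [φ, piecewise_eq_of_notMem _ _ _ hz]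
      exact fun h0 => hz (sub_eq_zero.1 h0 ▸ hpU)
  obtain ⟨R, hR0, hR⟩ := hb.subset_ball_lt 0 p
  refine not_hasLogOn_sphere p hR0 (((hasLogOn_univ hφ hφ0).mono (subset_univ _)).congr ?_)
  intro z hz
  have hzU : z ∉ U := fun h => by
    exact (mem_ball.1 (hR h)).ne (mem_sphere.1 hz)
  simp only [φ, piecewise_eq_of_notMem _ _ _ hzU]

/-- **Borsuk's separation criterion**. -/
theorem mem_connectedComponentIn_compl_iff_hasLogOn {K : Set ℂ} (hK : IsCompact K) {p q : ℂ}
    (hp : p ∈ Kᶜ) (hq : q ∈ Kᶜ) :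
    q ∈ connectedComponentIn Kᶜ p ↔ HasLogOn (fun z => (z - p) / (z - q)) K := by
  refine ⟨hasLogOn_div_of_mem_connectedComponentIn hK.isClosed, fun h => ?_⟩
  by_cases hbp : Bornology.IsBounded (connectedComponentIn Kᶜ p)
  · exact mem_connectedComponentIn_of_isBounded hK.isClosed hp hbp h
  by_cases hbq : Bornology.IsBounded (connectedComponentIn Kᶜ q)
  · have := mem_connectedComponentIn_of_isBounded hK.isClosed (p := q) (q := p) hq hbq
      (h.inv.congr fun z _ => inv_div _ _)
    rw [← connectedComponentIn_eq this]
    exact mem_connectedComponentIn hq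
  · rw [connectedComponentIn_eq_of_not_isBounded (by simp) hK.isBounded hbp hbq]
    exact mem_connectedComponentIn hq

theorem HasLogOn.union {f : ℂ → ℂ} {A B : Set ℂ} (hA : IsClosed A) (hB : IsClosed B)
    (hAB : IsPreconnected (A ∩ B)) (h₁ : HasLogOn f A) (h₂ : HasLogOn f B) :
    HasLogOn f (A ∪ B) := by
  classical
  obtain ⟨a, hac, ha⟩ := h₁
  obtain ⟨b, hbc, hb⟩ := h₂
  obtain ⟨n, hn⟩ : ∃ n : ℤ, ∀ z ∈ A ∩ B, a z = b z + n * (2 * Real.pi * I) := by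
    have hZ : ∀ z, ∃ n : ℤ, z ∈ A ∩ B → a z = b z + n * (2 * Real.pi * I) := fun z => by
      by_cases hz : z ∈ A ∩ B
      · obtain ⟨n, hn⟩ := exp_eq_exp_iff_exists_int.1 ((ha z hz.1).trans (hb z hz.2).symm)
        exact ⟨n, fun _ => hn⟩
      · exact ⟨0, fun h => absurd h hz⟩
    choose n hn using hZ
    have hnc : ContinuousOn n (A ∩ B) := by
      rw [Int.isClosedEmbedding_coe_real.isEmbedding.continuousOn_iff]
      have hd : ContinuousOn (fun z => ((a z - b z) / (2 * Real.pi * I)).re) (A ∩ B) := by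
        have := hac.mono (inter_subset_left (t := B))
        have := hbc.mono (inter_subset_right (s := A))
        fun_prop
      refine hd.congr fun z hz => ?_
      have : (a z - b z) / (2 * Real.pi * I) = n z := by
        rw [hn z hz, add_sub_cancel_left, mul_div_cancel_right₀ _ two_pi_I_ne_zero]
      simp [this]
    rcases (A ∩ B).eq_empty_or_nonempty with he | ⟨z₀, hz₀⟩
    · exact ⟨0, fun z hz => absurd hz (he ▸ notMem_empty z)⟩
    · exact ⟨n z₀, fun z hz => by rw [hn z hz, hAB.constant hnc hz hz₀]⟩
  let b' : ℂ → ℂ := fun z => b z + n * (2 * Real.pi * I)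
  have hb'c : ContinuousOn b' B := by fun_prop
  refine ⟨A.piecewise a b', ContinuousOn.union_of_isClosed ?_ ?_ hA hB, ?_⟩
  · exact hac.congr fun z hz => piecewise_eq_of_mem _ _ _ hz
  · refine hb'c.congr fun z hz => ?_
    by_cases hzA : z ∈ A
    · rw [piecewise_eq_of_mem _ _ _ hzA, hn z ⟨hzA, hz⟩]
    · rw [piecewise_eq_of_notMem _ _ _ hzA]
  · intro z hz
    by_cases hzA : z ∈ A
    · rw [piecewise_eq_of_mem _ _ _ hzA, ha z hzA]
    · rw [piecewise_eq_of_notMem _ _ _ hzA]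
      have hzB := hz.resolve_left hzA
      rw [← hb z hzB]
      exact exp_eq_exp_iff_exists_int.2 ⟨n, rfl⟩

theorem hasLogOn_range {γ : C(unitInterval, ℂ)} (hγ : Function.Injective γ) {f : ℂ → ℂ}
    (hf : ContinuousOn f (range γ)) (h0 : ∀ z ∈ range γ, f z ≠ 0) : HasLogOn f (range γ) := by
  let φ : ℝ → ℂ := fun t => f (γ (projIcc 0 1 zero_le_one t))
  have hφ : Continuous φ := hf.comp_continuous (γ.continuous.comp continuous_projIcc)
    fun t => mem_range_self _
  obtain ⟨F, ⟨-, hF⟩, -⟩ := isCoveringMapOn_exp.existsUnique_continuousMap_lifts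
    (A := ℝ) ⟨φ, hφ⟩ (a₀ := 0) (e₀ := log (φ 0)) (exp_log (h0 _ (mem_range_self _)))
    (fun t => h0 _ (mem_range_self _))
  have he : IsClosedEmbedding γ := γ.continuous.isClosedEmbedding hγ
  let k : ℂ → unitInterval := Function.invFun γ
  have hk : ∀ t, k (γ t) = t := Function.leftInverse_invFun hγ
  refine ⟨fun z => F (k z), ?_, ?_⟩
  · rw [continuousOn_iff_continuous_domRestrict, ← he.isEmbedding.toHomeomorph.comp_continuous_iff']
    have : ((range γ).domRestrict fun z => F (k z)) ∘ he.isEmbedding.toHomeomorph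
        = fun t : unitInterval => F t := by
      ext t
      simp [hk t]
    rw [this]
    fun_prop
  · rintro _ ⟨t, rfl⟩
    simp only [hk t]
    have := congr_fun hF t
    simpa [φ] using this

/-- **Janiszewski's theorem** in the complex plane. -/
theorem mem_connectedComponentIn_compl_union_complex {A B : Set ℂ} (hA : IsCompact A)
    (hB : IsCompact B) (hAB : IsPreconnected (A ∩ B)) {p q : ℂ}
    (h₁ : q ∈ connectedComponentIn Aᶜ p) (h₂ : q ∈ connectedComponentIn Bᶜ p) :
    q ∈ connectedComponentIn (A ∪ B)ᶜ p := by
  have hpA : p ∈ Aᶜ := connectedComponentIn_nonempty_iff.1 ⟨q, h₁⟩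
  have hpB : p ∈ Bᶜ := connectedComponentIn_nonempty_iff.1 ⟨q, h₂⟩
  have hqA := connectedComponentIn_subset _ _ h₁
  have hqB := connectedComponentIn_subset _ _ h₂
  rw [mem_connectedComponentIn_compl_iff_hasLogOn (hA.union hB)
    (by rw [compl_union]; exact ⟨hpA, hpB⟩) (by rw [compl_union]; exact ⟨hqA, hqB⟩)]
  rw [mem_connectedComponentIn_compl_iff_hasLogOn hA hpA hqA] at h₁
  rw [mem_connectedComponentIn_compl_iff_hasLogOn hB hpB hqB] at h₂
  exact h₁.union hA.isClosed hB.isClosed hAB h₂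

theorem isPreconnected_compl_range_complex {γ : C(unitInterval, ℂ)} (hγ : Function.Injective γ) :
    IsPreconnected (range γ)ᶜ := by
  have hK : IsCompact (range γ) := isCompact_range γ.continuous
  refine isPreconnected_of_forall_pair fun p hp q hq => ?_
  refine ⟨_, connectedComponentIn_subset (range γ)ᶜ p, mem_connectedComponentIn hp, ?_,
    isPreconnected_connectedComponentIn⟩
  have hne : ∀ w ∈ (range γ)ᶜ, ∀ z ∈ range γ, z - w ≠ 0 := fun w hw z hz h0 =>
    hw (sub_eq_zero.1 h0 ▸ hz)
  rw [mem_connectedComponentIn_compl_iff_hasLogOn hK hp hq]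
  exact hasLogOn_range hγ (ContinuousOn.div (by fun_prop) (by fun_prop) (hne q hq))
    fun z hz => div_ne_zero (hne p hp z hz) (hne q hq z hz)

end Logarithm

theorem one_lt_rank_real_prod_real : 1 < Module.rank ℝ (ℝ × ℝ) := by
  rw [rank_prod']
  simp only [Module.rank_self]
  norm_num

/-- **Janiszewski's theorem**: if neither of two compact plane sets with connected intersection
separates `p` from `q`, then neither does their union. -/
theorem mem_connectedComponentIn_compl_union {A B : Set (ℝ × ℝ)} (hA : IsCompact A)
    (hB : IsCompact B) (hAB : IsPreconnected (A ∩ B)) {p q : ℝ × ℝ}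
    (h₁ : q ∈ connectedComponentIn Aᶜ p) (h₂ : q ∈ connectedComponentIn Bᶜ p) :
    q ∈ connectedComponentIn (A ∪ B)ᶜ p := by
  let e : ℝ × ℝ ≃ₜ ℂ := Complex.equivRealProdCLM.symm.toHomeomorph
  have key : ∀ S : Set (ℝ × ℝ), p ∈ Sᶜ →
      e '' connectedComponentIn Sᶜ p = connectedComponentIn (e '' S)ᶜ (e p) := fun S hp => by
    rw [e.image_connectedComponentIn hp, image_compl_eq e.bijective]
  have hpA : p ∈ Aᶜ := connectedComponentIn_nonempty_iff.1 ⟨q, h₁⟩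
  have hpB : p ∈ Bᶜ := connectedComponentIn_nonempty_iff.1 ⟨q, h₂⟩
  have hpAB : p ∈ (A ∪ B)ᶜ := by rw [compl_union]; exact ⟨hpA, hpB⟩
  rw [← e.injective.mem_set_image, key _ hpAB, image_union]
  rw [← e.injective.mem_set_image, key _ hpA] at h₁
  rw [← e.injective.mem_set_image, key _ hpB] at h₂
  refine mem_connectedComponentIn_compl_union_complex (hA.image e.continuous)
    (hB.image e.continuous) ?_ h₁ h₂
  rw [← image_inter e.injective]
  exact hAB.image _ e.continuous.continuousOn

theorem isPreconnected_compl_union {A B : Set (ℝ × ℝ)} (hA : IsCompact A) (hB : IsCompact B)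
    (hAB : IsPreconnected (A ∩ B)) (h₁ : IsPreconnected Aᶜ) (h₂ : IsPreconnected Bᶜ) :
    IsPreconnected (A ∪ B)ᶜ := by
  refine isPreconnected_of_forall_pair fun p hp q hq => ?_
  refine ⟨_, connectedComponentIn_subset (A ∪ B)ᶜ p, mem_connectedComponentIn hp, ?_,
    isPreconnected_connectedComponentIn⟩
  rw [compl_union] at hp hq
  apply mem_connectedComponentIn_compl_union hA hB hAB
  · rw [h₁.connectedComponentIn hp.1]; exact hq.1
  · rw [h₂.connectedComponentIn hp.2]; exact hq.2

/-- An arc does not separate the plane. -/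
theorem isPreconnected_compl_range {γ : C(unitInterval, ℝ × ℝ)} (hγ : Function.Injective γ) :
    IsPreconnected (range γ)ᶜ := by
  let e : ℝ × ℝ ≃ₜ ℂ := Complex.equivRealProdCLM.symm.toHomeomorph
  rw [← e.isPreconnected_image, image_compl_eq e.bijective, ← range_comp]
  exact isPreconnected_compl_range_complex (γ := (e : C(ℝ × ℝ, ℂ)).comp γ)
    (e.injective.comp hγ)

/-- An arc in the plane has empty interior. -/
theorem interior_range_eq_empty {γ : C(unitInterval, ℝ × ℝ)} (hγ : Function.Injective γ) :
    interior (range γ) = ∅ := by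
  by_contra hne
  obtain ⟨z, hz, hz'⟩ :=
    ((toFinite ({γ 0, γ 1} : Set (ℝ × ℝ))).countable.dense_compl ℝ).inter_open_nonempty _
    isOpen_interior (nonempty_iff_ne_empty.2 hne)
  obtain ⟨m, rfl⟩ := interior_subset hz
  simp only [mem_compl_iff, mem_insert_iff, mem_singleton_iff, not_or] at hz'
  obtain ⟨ε, hε, hb⟩ := Metric.isOpen_iff.1 isOpen_interior _ hz
  obtain ⟨ρ, hρ, hρ'⟩ : ∃ ρ > 0, ρ < min ε (min (dist (γ 0) (γ m)) (dist (γ 1) (γ m))) :=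
    exists_between (lt_min hε (lt_min (dist_pos.2 (Ne.symm hz'.1)) (dist_pos.2 (Ne.symm hz'.2))))
  rw [lt_min_iff, lt_min_iff] at hρ'
  have hd : Continuous fun t => dist (γ t) (γ m) := by fun_prop
  obtain ⟨s, hs, hsρ⟩ := intermediate_value_Icc' (unitInterval.nonneg' : 0 ≤ m)
    hd.continuousOn ⟨by rw [dist_self]; exact hρ.le, hρ'.2.1.le⟩
  obtain ⟨t, ht, htρ⟩ := intermediate_value_Icc (unitInterval.le_one' : m ≤ 1)
    hd.continuousOn ⟨by rw [dist_self]; exact hρ.le, hρ'.2.2.le⟩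
  have hS : IsPreconnected (γ ⁻¹' sphere (γ m) ρ) := by
    have he : IsClosedEmbedding γ := γ.continuous.isClosedEmbedding hγ
    rw [← he.isInducing.isPreconnected_image, image_preimage_eq_of_subset]
    · exact isPreconnected_sphere one_lt_rank_real_prod_real _ _
    · exact fun w hw => interior_subset (hb ((mem_sphere.1 hw).trans_lt hρ'.1))
  have := hS.ordConnected.out hsρ htρ ⟨hs.2, ht.1⟩
  simp at this
  exact hρ.ne this

/-- A component of the complement of `C` is adherent to any point `x ∈ C` such that `C` minus any
neighbourhood of `x` is covered by a closed subset of `C` missing `x` and not separating. -/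
theorem mem_closure_of_forall_nhds {X : Type*} [TopologicalSpace X] {C E : Set X} {x : X}
    (hEC : E ⊆ Cᶜ) (hE : E.Nonempty) (hfr : frontier E ⊆ C)
    (h : ∀ N ∈ 𝓝 x, ∃ S ⊆ C, C \ N ⊆ S ∧ x ∉ S ∧ IsPreconnected Sᶜ) : x ∈ closure E := by
  by_contra hx
  obtain ⟨S, hSC, hS, hxS, hSp⟩ := h _ (isClosed_closure.isOpen_compl.mem_nhds hx)
  obtain ⟨q, hq⟩ := hE
  refine hx (subset_closure (hSp.subset_of_disjoint_frontier (V := E)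
    ⟨q, fun h => hEC hq (hSC h), hq⟩ ?_ hxS))
  exact disjoint_compl_left_iff_subset.2 fun z hz => hS ⟨hfr hz, fun h => h hz.1⟩

end PlaneTopology

namespace PlaneGraph

open Topology Bornology

variable {G : PlaneGraph} {u v w x y : ℝ × ℝ}

theorem Adj.ne' (h : G.Adj v w) : v ≠ w := fun he => G.adj_irrefl w (he ▸ h)

section Arc

theorem isCompact_arc (h : G.Adj v w) : IsCompact (G.arc v w) := by
  obtain ⟨γ, -, hr⟩ := G.arc_path v w h
  exact hr ▸ isCompact_range γ.continuous

theorem isPreconnected_arc (h : G.Adj v w) : IsPreconnected (G.arc v w) := by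
  obtain ⟨γ, -, hr⟩ := G.arc_path v w h
  exact hr ▸ isPreconnected_range γ.continuous

theorem isPreconnected_compl_arc (h : G.Adj v w) : IsPreconnected (G.arc v w)ᶜ := by
  obtain ⟨γ, hγ, hr⟩ := G.arc_path v w h
  exact hr ▸ isPreconnected_compl_range (γ := γ.toContinuousMap) hγ

theorem interior_arc (h : G.Adj v w) : interior (G.arc v w) = ∅ := by
  obtain ⟨γ, hγ, hr⟩ := G.arc_path v w h
  exact hr ▸ interior_range_eq_empty (γ := γ.toContinuousMap) hγ

theorem left_mem_arc (h : G.Adj v w) : v ∈ G.arc v w := by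
  obtain ⟨γ, -, hr⟩ := G.arc_path v w h
  exact hr ▸ ⟨0, γ.source⟩

theorem right_mem_arc (h : G.Adj v w) : w ∈ G.arc v w := by
  obtain ⟨γ, -, hr⟩ := G.arc_path v w h
  exact hr ▸ ⟨1, γ.target⟩

theorem exists_mem_arc_ne (h : G.Adj v w) : ∃ z ∈ G.arc v w, z ≠ v ∧ z ≠ w := by
  obtain ⟨γ, hγ, hr⟩ := G.arc_path v w h
  obtain ⟨t, h0, h1⟩ := exists_between (zero_lt_one : (0 : unitInterval) < 1)
  refine ⟨γ t, hr ▸ mem_range_self t, fun he => h0.ne' (hγ ?_), fun he => h1.ne (hγ ?_)⟩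
  · rw [he, γ.source]
  · rw [he, γ.target]

theorem arc_inter_arc (hv : G.Adj x v) (hw : G.Adj x w) (hne : v ≠ w) :
    G.arc x v ∩ G.arc x w = {x} := by
  apply Subset.antisymm
  · intro z hz
    have hs : ({x, v} : Set (ℝ × ℝ)) ≠ {x, w} := fun he => by
      have : v ∈ ({x, w} : Set (ℝ × ℝ)) := he ▸ mem_insert_of_mem _ rfl
      rcases this with h | h
      · exact Adj.ne' hv h.symm
      · exact hne h
    obtain ⟨h1 | h1, h2 | h2⟩ := G.arc_inter _ _ _ _ hv hw hs hz
    · exact h1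
    · exact h1
    · exact h2
    · exact absurd (h1.symm.trans h2) hne
  · rintro _ rfl
    exact ⟨left_mem_arc hv, left_mem_arc hw⟩

/-- Cutting a small piece at its first end off an arc. -/
theorem exists_subset_arc_notMem (h : G.Adj v w) {N : Set (ℝ × ℝ)} (hN : N ∈ 𝓝 v) :
    ∃ S ⊆ G.arc v w, IsCompact S ∧ v ∉ S ∧ w ∈ S ∧ IsPreconnected Sᶜ ∧ G.arc v w \ N ⊆ S := by
  obtain ⟨γ, hγ, hr⟩ := G.arc_path v w h
  have hN' : γ ⁻¹' N ∈ 𝓝 (0 : unitInterval) :=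
    γ.continuous.continuousAt.preimage_mem_nhds (by rwa [γ.source])
  obtain ⟨δ, hδ, hδN⟩ := Metric.mem_nhds_iff.1 hN'
  obtain ⟨ε, hε0, hε⟩ := exists_between (lt_min hδ one_pos)
  rw [lt_min_iff] at hε
  let k : unitInterval → unitInterval := fun s =>
    ⟨1 - (1 - ε) * (1 - s), by
      have h1 := s.2.1
      have h2 := s.2.2
      constructor <;> nlinarith [mul_nonneg (sub_nonneg.2 hε.2.le) (sub_nonneg.2 h2)]⟩
  have hkv : ∀ s, (k s : ℝ) = 1 - (1 - ε) * (1 - s) := fun _ => rfl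
  have hk : Continuous k := by fun_prop
  have h1ε : 1 - ε ≠ 0 := (sub_pos.2 hε.2).ne'
  have hki : Function.Injective k := fun s t hst => by
    have := congr_arg Subtype.val hst
    rw [hkv, hkv, sub_right_inj, mul_right_inj' h1ε, sub_right_inj] at this
    exact Subtype.ext this
  refine ⟨range (γ ∘ k), ?_, isCompact_range (γ.continuous.comp hk), ?_, ⟨1, ?_⟩,
    isPreconnected_compl_range (γ := γ.toContinuousMap.comp ⟨k, hk⟩) (hγ.comp hki), ?_⟩
  · rw [hr]; exact range_comp_subset_range _ _
  · rintro ⟨s, hs⟩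
    have := congr_arg Subtype.val (hγ (hs.trans γ.source.symm))
    rw [hkv] at this
    have h1 := s.2.1
    simp at this
    nlinarith [mul_nonneg (sub_nonneg.2 hε.2.le) h1]
  · have : k 1 = 1 := Subtype.ext (by simp [hkv])
    simp [this]
  · rintro z ⟨hz, hzN⟩
    rw [hr] at hz
    obtain ⟨t, rfl⟩ := hz
    have ht : ε ≤ t := by
      by_contra hlt
      refine hzN (hδN ?_)
      rw [Metric.mem_ball, Subtype.dist_eq, Real.dist_eq]
      have := t.2.1
      simp only [Icc.coe_zero, sub_zero, abs_of_nonneg this]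
      linarith
    have h2 := t.2.2
    have h3 := sub_pos.2 hε.2
    refine ⟨⟨1 - (1 - t) / (1 - ε), ?_, ?_⟩, ?_⟩
    · rw [sub_nonneg, div_le_one h3]; linarith
    · rw [sub_le_self_iff]; exact div_nonneg (by linarith) h3.le
    · refine congr_arg γ (Subtype.ext ?_)
      rw [hkv]
      field_simp
      ring

end Arc

/-- A vertex `x` of a simple closed curve, consisting of the arcs from `x` to `v` and `w` and a set
`B` joining `v` to `w`, is adherent to every component of the complement of the curve. -/
theorem mem_closure_connectedComponentIn_of_cycle (hv : G.Adj x v) (hw : G.Adj x w) (hvw : v ≠ w)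
    {B : Set (ℝ × ℝ)} (hB : IsCompact B) (hBc : IsPreconnected Bᶜ) (hvB : G.arc x v ∩ B = {v})
    (hwB : G.arc x w ∩ B = {w}) {q : ℝ × ℝ} (hq : q ∈ (G.arc x v ∪ B ∪ G.arc x w)ᶜ) :
    x ∈ closure (connectedComponentIn (G.arc x v ∪ B ∪ G.arc x w)ᶜ q) := by
  have hC : IsCompact (G.arc x v ∪ B ∪ G.arc x w) :=
    ((isCompact_arc hv).union hB).union (isCompact_arc hw)
  have hxB : x ∉ B := fun h => Adj.ne' hv (hvB.subset ⟨left_mem_arc hv, h⟩)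
  refine mem_closure_of_forall_nhds (connectedComponentIn_subset _ _)
    ⟨q, mem_connectedComponentIn hq⟩ (frontier_connectedComponentIn_compl_subset hC.isClosed q)
    fun N hN => ?_
  obtain ⟨S, hSv, hSc, hxS, hvS, hSp, hSN⟩ := exists_subset_arc_notMem hv hN
  obtain ⟨S', hSw, hSc', hxS', hwS', hSp', hSN'⟩ := exists_subset_arc_notMem hw hN
  refine ⟨S ∪ B ∪ S', by gcongr, ?_, by simp [hxS, hxB, hxS'], ?_⟩
  · rw [union_sdiff_distrib, union_sdiff_distrib]
    gcongr
    exact sdiff_subset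
  · have h1 : S ∩ B = {v} := by
      apply Subset.antisymm (fun z hz => hvB.subset ⟨hSv hz.1, hz.2⟩)
      rintro _ rfl
      exact ⟨hvS, (hvB.superset rfl).2⟩
    have h2 : (S ∪ B) ∩ S' = {w} := by
      apply Subset.antisymm
      · rintro z ⟨hz | hz, hz'⟩
        · have := (arc_inter_arc hv hw hvw).subset ⟨hSv hz, hSw hz'⟩
          exact absurd (this ▸ hz) hxS
        · exact hwB.subset ⟨hSw hz', hz⟩
      · rintro _ rfl
        exact ⟨Or.inr (hwB.superset rfl).2, hwS'⟩
    refine isPreconnected_compl_union (hSc.union hB) hSc' (h2 ▸ isPreconnected_singleton) ?_ hSp'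
    exact isPreconnected_compl_union hSc hB (h1 ▸ isPreconnected_singleton) hSp hBc

section Drawing

theorem adj_mem' (h : G.Adj v w) : w ∈ G.verts := G.adj_mem _ _ (G.adj_symm _ _ h)

theorem arc_subset_drawing (h : G.Adj v w) : G.arc v w ⊆ G.drawing :=
  fun _ hz => Or.inr (mem_iUnion₂.2 ⟨v, w, mem_iUnion.2 ⟨h, hz⟩⟩)

theorem mem_drawing_iff {z : ℝ × ℝ} :
    z ∈ G.drawing ↔ z ∈ G.verts ∨ ∃ v w, G.Adj v w ∧ z ∈ G.arc v w := by
  simp [drawing]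

variable (G) in
/-- The ordered pairs of adjacent vertices. -/
def darts : Set ((ℝ × ℝ) × (ℝ × ℝ)) := {e | G.Adj e.1 e.2}

variable (G) in
theorem finite_darts : G.darts.Finite :=
  (G.finite_verts.prod G.finite_verts).subset fun _ he => ⟨G.adj_mem _ _ he, adj_mem' he⟩

variable (G) in
theorem drawing_eq : G.drawing = G.verts ∪ ⋃ e ∈ G.darts, G.arc e.1 e.2 := by
  ext z
  simp [drawing, darts]

variable (G) in
theorem isCompact_drawing : IsCompact G.drawing := by
  rw [drawing_eq]
  exact G.finite_verts.isCompact.union (G.finite_darts.isCompact_biUnion fun e he =>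
    isCompact_arc he)

variable (G) in
theorem dense_compl_drawing : Dense G.drawingᶜ := by
  rw [drawing_eq, compl_union, compl_iUnion₂]
  refine (G.finite_verts.countable.dense_compl ℝ).inter_of_isOpen_left ?_
    G.finite_verts.isClosed.isOpen_compl
  refine dense_biInter_of_isOpen (fun e he => (isCompact_arc he).isClosed.isOpen_compl)
    G.finite_darts.countable fun e he => ?_
  exact interior_eq_empty_iff_dense_compl.1 (interior_arc he)

theorem mem_of_mem_arc {z : ℝ × ℝ} (h : G.Adj v w) (hz : z ∈ G.arc v w) (hzG : z ∈ G.verts) :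
    z = v ∨ z = w :=
  G.arc_verts _ _ h ⟨hzG, hz⟩

theorem IsTriangle.mem_triDrawing {a b c : ℝ × ℝ} (h : G.IsTriangle a b c) :
    a ∈ G.triDrawing a b c ∧ b ∈ G.triDrawing a b c ∧ c ∈ G.triDrawing a b c :=
  ⟨Or.inl (Or.inl (left_mem_arc h.2.2.2.1)), Or.inl (Or.inl (right_mem_arc h.2.2.2.1)),
    Or.inl (Or.inr (right_mem_arc h.2.2.2.2.1))⟩

theorem IsTriangle.eq_of_mem_triDrawing {a b c z : ℝ × ℝ} (h : G.IsTriangle a b c)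
    (hz : z ∈ G.triDrawing a b c) (hzG : z ∈ G.verts) : z = a ∨ z = b ∨ z = c := by
  obtain ⟨-, -, -, hab, hbc, hac⟩ := h
  rcases hz with (hz | hz) | hz
  · have := mem_of_mem_arc hab hz hzG; tauto
  · have := mem_of_mem_arc hbc hz hzG; tauto
  · have := mem_of_mem_arc hac hz hzG; tauto

theorem IsTriangle.isCompact_triDrawing {a b c : ℝ × ℝ} (h : G.IsTriangle a b c) :
    IsCompact (G.triDrawing a b c) :=
  ((isCompact_arc h.2.2.2.1).union (isCompact_arc h.2.2.2.2.1)).union (isCompact_arc h.2.2.2.2.2)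

theorem IsTriangle.rotate {a b c : ℝ × ℝ} (h : G.IsTriangle a b c) : G.IsTriangle b c a :=
  ⟨h.2.2.1, h.1.symm, h.2.1.symm, h.2.2.2.2.1, G.adj_symm _ _ h.2.2.2.2.2,
    G.adj_symm _ _ h.2.2.2.1⟩

theorem triDrawing_rotate (a b c : ℝ × ℝ) : G.triDrawing b c a = G.triDrawing a b c := by
  unfold triDrawing
  rw [G.arc_symm c a, G.arc_symm b a]
  ac_rfl

theorem triDrawing_swap (a b c : ℝ × ℝ) : G.triDrawing a c b = G.triDrawing a b c := by
  unfold triDrawing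
  rw [G.arc_symm c b]
  ac_rfl

end Drawing

theorem exists_unbounded_face (G : PlaneGraph) :
    ∃ q ∈ G.drawingᶜ, ¬ IsBounded (connectedComponentIn G.drawingᶜ q) :=
  exists_not_isBounded_connectedComponentIn one_lt_rank_real_prod_real
    (isCompact_drawing G).isBounded

theorem IsBadFor.eq_or_eq {b c : ℝ × ℝ} (hx : G.IsBadFor u x) (h : G.IsTriangle x b c) :
    u = b ∨ u = c := by
  by_contra! hu
  exact hx.2.2 ⟨b, c, h.1, h.2.1, h.2.2.1, ⟨h.2.2.2.1, hx.2.1, hu.1.symm⟩,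
    ⟨h.2.2.2.2.1, hu.1.symm, hu.2.symm⟩, ⟨h.2.2.2.2.2, hx.2.1, hu.2.symm⟩⟩

theorem IsBadFor.adj (hG : G.IsWNT) (hx : G.IsBadFor u x) : G.Adj x u := by
  obtain ⟨b, c, h⟩ := hG.2 x hx.1
  rcases hx.eq_or_eq h with rfl | rfl
  exacts [h.2.2.2.1, h.2.2.2.2.2]

/-- The triangles avoiding a vertex stay away from it. -/
theorem eventually_notMem_triDrawing (G : PlaneGraph) (x : ℝ × ℝ) :
    ∀ᶠ z in 𝓝 x, ∀ a b c, G.IsTriangle a b c → x ∉ G.triDrawing a b c →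
      z ∉ G.triDrawing a b c := by
  have hfin : {t : (ℝ × ℝ) × (ℝ × ℝ) × (ℝ × ℝ) | G.IsTriangle t.1 t.2.1 t.2.2}.Finite :=
    (G.finite_verts.prod (G.finite_verts.prod G.finite_verts)).subset fun t ht =>
      ⟨G.adj_mem _ _ ht.2.2.2.1, adj_mem' ht.2.2.2.1, adj_mem' ht.2.2.2.2.1⟩
  have := (Filter.eventually_all_finite hfin (l := 𝓝 x)
    (p := fun t z => x ∉ G.triDrawing t.1 t.2.1 t.2.2 → z ∉ G.triDrawing t.1 t.2.1 t.2.2)).2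
    fun t ht => by
      by_cases hx : x ∈ G.triDrawing t.1 t.2.1 t.2.2
      · simp [hx]
      · filter_upwards [(IsTriangle.isCompact_triDrawing ht).isClosed.isOpen_compl.mem_nhds hx]
          with z hz _ using hz
  filter_upwards [this] with z hz a b c h using hz (a, b, c) h

/-- Every open set adherent to an internal bad vertex `x` meets a face bounded by a triangle
through `x` and `u`. -/
theorem IsBadFor.exists_face (hG : G.IsWNT) (hx : G.IsBadFor u x) (hext : ¬ G.ExternalVertex x)
    {E : Set (ℝ × ℝ)} (hE : IsOpen E) (hxE : x ∈ closure E) :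
    ∃ Φ y, G.Adj x y ∧ G.Adj u y ∧ IsPreconnected Φ ∧ IsBounded Φ ∧ Disjoint Φ G.drawing ∧
      (Φ ∩ E).Nonempty ∧ frontier Φ = G.arc x u ∪ G.arc u y ∪ G.arc x y := by
  obtain ⟨q, hq, hqb⟩ := exists_unbounded_face G
  have hxq : x ∉ closure (connectedComponentIn G.drawingᶜ q) := fun h =>
    hext ⟨hx.1, _, ⟨q, hq, rfl⟩, hqb, h⟩
  obtain ⟨r, hr, hball⟩ := Metric.eventually_nhds_iff_ball.1 ((eventually_notMem_triDrawing G x).and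
    (isClosed_closure.isOpen_compl.mem_nhds hxq))
  obtain ⟨e, heb, heE⟩ := mem_closure_iff.1 hxE _ Metric.isOpen_ball (Metric.mem_ball_self hr)
  obtain ⟨p, ⟨hpb, hpE⟩, hp⟩ := (dense_compl_drawing G).inter_open_nonempty _
    (Metric.isOpen_ball.inter hE) ⟨e, heb, heE⟩
  have hpΦ := mem_connectedComponentIn hp
  have hΦb : IsBounded (connectedComponentIn G.drawingᶜ p) := by
    by_contra hb
    refine (hball p hpb).2 (subset_closure ?_)
    rwa [← connectedComponentIn_eq_of_not_isBounded one_lt_rank_real_prod_real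
      (isCompact_drawing G).isBounded hb hqb]
  have hΦd : Disjoint (connectedComponentIn G.drawingᶜ p) G.drawing :=
    disjoint_left.2 fun z hz => connectedComponentIn_subset _ _ hz
  obtain ⟨a, b, c, habc, hfr⟩ := hG.1 _ ⟨p, hp, rfl⟩ hΦb
  have hxabc : x ∈ G.triDrawing a b c := by
    by_contra hxn
    obtain ⟨z, hz, hzfr⟩ := (convex_ball x r).isPreconnected.inter_frontier_nonempty'
      ⟨p, hpb, hpΦ⟩ ⟨x, Metric.mem_ball_self hr, fun h => hΦd.le_bot ⟨h, Or.inl hx.1⟩⟩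
    exact (hball z hz).1 a b c habc hxn (hfr ▸ hzfr)
  obtain ⟨b', c', h', hfr'⟩ : ∃ b' c', G.IsTriangle x b' c' ∧
      frontier (connectedComponentIn G.drawingᶜ p) = G.triDrawing x b' c' := by
    rcases habc.eq_of_mem_triDrawing hxabc hx.1 with rfl | rfl | rfl
    · exact ⟨b, c, habc, hfr⟩
    · exact ⟨c, a, habc.rotate, hfr.trans (triDrawing_rotate _ _ _).symm⟩
    · refine ⟨a, b, habc.rotate.rotate, hfr.trans ?_⟩
      rw [triDrawing_rotate, triDrawing_rotate]
  rcases hx.eq_or_eq h' with rfl | rfl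
  · exact ⟨_, c', h'.2.2.2.2.2, h'.2.2.2.2.1, isPreconnected_connectedComponentIn, hΦb, hΦd,
      ⟨p, hpΦ, hpE⟩, hfr'⟩
  · exact ⟨_, b', h'.2.2.2.1, G.adj_symm _ _ h'.2.2.2.2.1, isPreconnected_connectedComponentIn, hΦb,
      hΦd, ⟨p, hpΦ, hpE⟩, hfr'.trans (triDrawing_swap _ _ _).symm⟩

theorem eq_of_mem_arc_of_mem_arc {v' w' z : ℝ × ℝ} (h : G.Adj v w) (h' : G.Adj v' w')
    (h1 : v ≠ v') (h2 : v ≠ w') (hz : z ∈ G.arc v w) (hz' : z ∈ G.arc v' w') :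
    z = w ∧ (z = v' ∨ z = w') := by
  have hne : ({v, w} : Set (ℝ × ℝ)) ≠ {v', w'} := fun he => by
    rcases (he ▸ mem_insert v {w} : v ∈ ({v', w'} : Set (ℝ × ℝ))) with h | h
    exacts [h1 h, h2 h]
  obtain ⟨h3 | h3, h4⟩ := G.arc_inter _ _ _ _ h h' hne ⟨hz, hz'⟩
  · subst h3
    rcases h4 with h4 | h4
    exacts [absurd h4 h1, absurd h4 h2]
  · exact ⟨h3, h4⟩

/-- The path from `v` through `y` to `w`. -/
def arc₂ (G : PlaneGraph) (v y w : ℝ × ℝ) : Set (ℝ × ℝ) := G.arc v y ∪ G.arc w y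

section ArcTwo

variable {y' z : ℝ × ℝ}

theorem isCompact_arc₂ (hv : G.Adj v y) (hw : G.Adj w y) : IsCompact (G.arc₂ v y w) :=
  (isCompact_arc hv).union (isCompact_arc hw)

theorem isPreconnected_arc₂ (hv : G.Adj v y) (hw : G.Adj w y) : IsPreconnected (G.arc₂ v y w) :=
  (isPreconnected_arc hv).union y (right_mem_arc hv) (right_mem_arc hw) (isPreconnected_arc hw)

theorem eq_or_eq_of_mem_arc_of_mem_arc₂ (hvw : G.Adj v w) (hv : G.Adj v y) (hw : G.Adj w y)
    (hz : z ∈ G.arc v w) (hz' : z ∈ G.arc₂ v y w) : z = v ∨ z = w := by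
  rcases hz' with h | h
  · exact Or.inl ((arc_inter_arc hvw hv (Adj.ne' hw)).subset ⟨hz, h⟩)
  · exact Or.inr ((eq_of_mem_arc_of_mem_arc hvw hw (Adj.ne' hvw) (Adj.ne' hv) hz h).1)

theorem eq_or_eq_of_mem_arc₂_of_mem_arc₂ (hvw : v ≠ w) (hv : G.Adj v y) (hw : G.Adj w y)
    (hv' : G.Adj v y') (hw' : G.Adj w y') (hne : y ≠ y')
    (hz : z ∈ G.arc₂ v y w) (hz' : z ∈ G.arc₂ v y' w) : z = v ∨ z = w := by
  rcases hz with h | h <;> rcases hz' with h' | h'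
  · exact Or.inl ((arc_inter_arc hv hv' hne).subset ⟨h, h'⟩)
  · obtain ⟨h1, h2⟩ := eq_of_mem_arc_of_mem_arc hv hw' hvw (Adj.ne' hv') h h'
    rcases h2 with h2 | h2
    exacts [Or.inr h2, absurd (h1.symm.trans h2) hne]
  · obtain ⟨h1, h2⟩ := eq_of_mem_arc_of_mem_arc hw hv' hvw.symm (Adj.ne' hw') h h'
    rcases h2 with h2 | h2
    exacts [Or.inl h2, absurd (h1.symm.trans h2) hne]
  · exact Or.inr ((arc_inter_arc hw hw' hne).subset ⟨h, h'⟩)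

end ArcTwo

/-- In a theta graph with a bounded face incident with two of the three paths, no other component
can be adherent to the interiors of both of these paths, if it is unbounded. -/
theorem false_of_mem_closure_theta {P A A' Φ : Set (ℝ × ℝ)} {q z z' : ℝ × ℝ} (hP : IsCompact P)
    (hA : IsCompact A) (hA' : IsCompact A') (hPA : P ∩ A ⊆ A') (hAc : IsPreconnected A')
    (hΦ : IsPreconnected Φ) (hΦn : Φ.Nonempty) (hΦb : IsBounded Φ)
    (hΦd : Disjoint Φ (P ∪ A ∪ A')) (hfr : frontier Φ = P ∪ A)
    (hE : ¬ IsBounded (connectedComponentIn (P ∪ A ∪ A')ᶜ q)) (hzP : z ∈ P)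
    (hz : z ∈ closure (connectedComponentIn (P ∪ A ∪ A')ᶜ q)) (hzA : z ∉ A ∪ A') (hzA' : z' ∈ A)
    (hz' : z' ∈ closure (connectedComponentIn (P ∪ A ∪ A')ᶜ q)) (hzP' : z' ∉ P ∪ A') : False := by
  obtain ⟨p, hp⟩ := hΦn
  have hq : q ∈ (P ∪ A ∪ A')ᶜ := by
    by_contra hq
    exact hE (by rw [connectedComponentIn_eq_empty hq]; exact isBounded_empty)
  have hEd : Disjoint (connectedComponentIn (P ∪ A ∪ A')ᶜ q) (P ∪ A ∪ A') :=
    disjoint_left.2 fun z hz => connectedComponentIn_subset _ _ hz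
  have hfrc : P ∪ A ⊆ closure Φ := hfr ▸ frontier_subset_closure
  have h1 : A ∪ A' ⊆ P ∪ A ∪ A' := union_subset_union_left _ subset_union_right
  have h2 : P ∪ A' ⊆ P ∪ A ∪ A' := union_subset_union_left _ subset_union_left
  have hint : (A ∪ A') ∩ (P ∪ A') = A' := by
    rw [← inter_union_distrib_right, inter_comm A P, union_eq_self_of_subset_left hPA]
  have key := mem_connectedComponentIn_compl_union (hA.union hA') (hP.union hA') (hint.symm ▸ hAc)
    (mem_connectedComponentIn_of_closure hΦ isPreconnected_connectedComponentIn
      (hΦd.mono_right h1) (hEd.mono_right h1) hp (mem_connectedComponentIn hq)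
      (hfrc (Or.inl hzP)) hz hzA)
    (mem_connectedComponentIn_of_closure hΦ isPreconnected_connectedComponentIn
      (hΦd.mono_right h2) (hEd.mono_right h2) hp (mem_connectedComponentIn hq)
      (hfrc (Or.inr hzA')) hz' hzP')
  rw [show A ∪ A' ∪ (P ∪ A') = P ∪ A ∪ A' by
    rw [← union_union_distrib_right, union_comm A P]] at key
  refine hE (hΦb.subset ?_)
  rw [← connectedComponentIn_eq key]
  exact connectedComponentIn_compl_subset hp (hfr ▸ subset_union_left)

/-- An unbounded component outside a theta graph, two of whose cycles through the arc from `x` to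
`u` bound faces, is not adherent to the interior of that arc. -/
theorem eq_or_eq_of_mem_closure_theta {y' q z : ℝ × ℝ} {Φ Φ' : Set (ℝ × ℝ)} (hxu : G.Adj x u)
    (hxy : G.Adj x y) (huy : G.Adj u y) (hxy' : G.Adj x y') (huy' : G.Adj u y') (hne : y ≠ y')
    (hΦ : IsPreconnected Φ) (hΦn : Φ.Nonempty) (hΦb : IsBounded Φ) (hΦd : Disjoint Φ G.drawing)
    (hfr : frontier Φ = G.arc x u ∪ G.arc₂ x y u)
    (hΦ' : IsPreconnected Φ') (hΦn' : Φ'.Nonempty) (hΦb' : IsBounded Φ')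
    (hΦd' : Disjoint Φ' G.drawing) (hfr' : frontier Φ' = G.arc x u ∪ G.arc₂ x y' u)
    (hE : ¬ IsBounded (connectedComponentIn (G.arc x u ∪ G.arc₂ x y u ∪ G.arc₂ x y' u)ᶜ q))
    (hzP : z ∈ G.arc x u)
    (hz : z ∈ closure (connectedComponentIn (G.arc x u ∪ G.arc₂ x y u ∪ G.arc₂ x y' u)ᶜ q)) :
    z = x ∨ z = u := by
  by_contra hzn
  have hP := isCompact_arc hxu
  have hA := isCompact_arc₂ hxy huy
  have hA' := isCompact_arc₂ hxy' huy'
  have hzA : z ∉ G.arc₂ x y u := fun h => hzn (eq_or_eq_of_mem_arc_of_mem_arc₂ hxu hxy huy hzP h)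
  have hzA' : z ∉ G.arc₂ x y' u := fun h =>
    hzn (eq_or_eq_of_mem_arc_of_mem_arc₂ hxu hxy' huy' hzP h)
  have hΘ : G.arc x u ∪ G.arc₂ x y u ∪ G.arc₂ x y' u ⊆ G.drawing := by
    simp only [arc₂, union_subset_iff]
    exact ⟨⟨arc_subset_drawing hxu, arc_subset_drawing hxy, arc_subset_drawing huy⟩,
      arc_subset_drawing hxy', arc_subset_drawing huy'⟩
  have hends : ∀ {b}, G.Adj x b → G.Adj u b → ∀ t, t = x ∨ t = u → t ∈ G.arc₂ x b u := by
    rintro b h h' _ (rfl | rfl)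
    exacts [Or.inl (left_mem_arc h), Or.inr (left_mem_arc h')]
  have hPends : ∀ t, t = x ∨ t = u → t ∈ G.arc x u := by
    rintro _ (rfl | rfl)
    exacts [left_mem_arc hxu, right_mem_arc hxu]
  have hcl := ((hP.union hA).union hA').isClosed
  have hEfr := frontier_connectedComponentIn_compl_subset hcl q
  have hEP : frontier (connectedComponentIn (G.arc x u ∪ G.arc₂ x y u ∪ G.arc₂ x y' u)ᶜ q) ⊆
      G.arc x u := by
    intro t ht
    by_contra htP
    have hAA' : t ∈ G.arc₂ x y u → t ∉ G.arc₂ x y' u := fun h h' => htP (hPends t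
      (eq_or_eq_of_mem_arc₂_of_mem_arc₂ (Adj.ne' hxu) hxy huy hxy' huy' hne h h'))
    rcases hEfr ht with (h | h) | h
    · exact htP h
    · exact false_of_mem_closure_theta hP hA hA' (fun s hs => hends hxy' huy' s
        (eq_or_eq_of_mem_arc_of_mem_arc₂ hxu hxy huy hs.1 hs.2)) (isPreconnected_arc₂ hxy' huy')
        hΦ hΦn hΦb (hΦd.mono_right hΘ) hfr hE hzP hz (by simp [hzA, hzA']) h
        (frontier_subset_closure ht) (by simp [htP, hAA' h])
    · rw [union_right_comm] at hΘ hE hz ht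
      exact false_of_mem_closure_theta hP hA' hA (fun s hs => hends hxy huy s
        (eq_or_eq_of_mem_arc_of_mem_arc₂ hxu hxy' huy' hs.1 hs.2)) (isPreconnected_arc₂ hxy huy)
        hΦ' hΦn' hΦb' (hΦd'.mono_right hΘ) hfr' hE hzP hz (by simp [hzA, hzA']) h
        (frontier_subset_closure ht) (by simp [htP, mt hAA' (not_not_intro h)])
  have hyP : y ∈ (G.arc x u)ᶜ := fun h => by
    rcases mem_of_mem_arc hxu h (adj_mem' hxy) with h | h
    exacts [Adj.ne' hxy h.symm, Adj.ne' huy h.symm]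
  have hEn : (connectedComponentIn (G.arc x u ∪ G.arc₂ x y u ∪ G.arc₂ x y' u)ᶜ q).Nonempty := by
    by_contra h
    exact hE (by rw [not_nonempty_iff_eq_empty.1 h]; exact isBounded_empty)
  obtain ⟨t, ht⟩ := hEn
  have := (isPreconnected_compl_arc hxu).subset_of_disjoint_frontier
    ⟨t, fun h => connectedComponentIn_subset _ _ ht (Or.inl (Or.inl h)), ht⟩
    (disjoint_compl_left_iff_subset.2 hEP) hyP
  exact connectedComponentIn_subset _ _ this (Or.inl (Or.inr (Or.inl (right_mem_arc hxy))))

theorem IsBadFor.externalVertex (hG : G.IsWNT) (hx : G.IsBadFor u x) : G.ExternalVertex x := by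
  by_contra hext
  have hxu := hx.adj hG
  obtain ⟨Φ, y, hxy, huy, hΦ, hΦb, hΦd, ⟨p, hp, -⟩, hfr⟩ :=
    hx.exists_face hG hext isOpen_univ (by simp)
  have hC : IsCompact (G.arc x u ∪ G.arc u y ∪ G.arc x y) :=
    ((isCompact_arc hxu).union (isCompact_arc huy)).union (isCompact_arc hxy)
  have hCd : G.arc x u ∪ G.arc u y ∪ G.arc x y ⊆ G.drawing :=
    union_subset (union_subset (arc_subset_drawing hxu) (arc_subset_drawing huy))
      (arc_subset_drawing hxy)
  obtain ⟨e, he, heb⟩ := exists_not_isBounded_connectedComponentIn one_lt_rank_real_prod_real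
    hC.isBounded
  have hinter : ∀ {a b c}, G.Adj a b → G.Adj b c → a ≠ c → G.arc a b ∩ G.arc b c = {b} :=
    fun {a b c} hab hbc hac => by
      rw [G.arc_symm a b]
      exact arc_inter_arc (G.adj_symm _ _ hab) hbc hac
  obtain ⟨Φ', y', hxy', huy', hΦ', hΦb', hΦd', ⟨p', hp', hpe⟩, hfr'⟩ :=
    hx.exists_face hG hext (hC.isClosed.isOpen_compl.connectedComponentIn (x := e))
      (mem_closure_connectedComponentIn_of_cycle hxu hxy (Adj.ne' huy) (isCompact_arc huy)
        (isPreconnected_compl_arc huy) (hinter hxu huy (Adj.ne' hxy))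
        (by rw [G.arc_symm u y]; exact hinter hxy (G.adj_symm _ _ huy) (Adj.ne' hxu)) he)
  have hne : y ≠ y' := by
    rintro rfl
    refine heb (hΦb'.subset ?_)
    rw [connectedComponentIn_eq hpe]
    exact connectedComponentIn_compl_subset hp' hfr'.subset
  have harc : ∀ b, G.arc x u ∪ G.arc u b ∪ G.arc x b = G.arc x u ∪ G.arc₂ x b u := fun b => by
    rw [arc₂, union_right_comm, union_assoc]
  rw [harc] at hfr hfr'
  have hΘ := ((isCompact_arc hxu).union (isCompact_arc₂ hxy huy)).union (isCompact_arc₂ hxy' huy')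
  obtain ⟨q, hq, hqb⟩ := exists_not_isBounded_connectedComponentIn one_lt_rank_real_prod_real
    hΘ.isBounded
  have hP : ∀ z ∈ G.arc x u, z ∈ closure (connectedComponentIn
      (G.arc x u ∪ G.arc₂ x y u ∪ G.arc₂ x y' u)ᶜ q) → z = x ∨ z = u := fun z =>
    eq_or_eq_of_mem_closure_theta hxu hxy huy hxy' huy' hne hΦ ⟨p, hp⟩ hΦb hΦd hfr
      hΦ' ⟨p', hp'⟩ hΦb' hΦd' hfr' hqb
  have hEfr := frontier_connectedComponentIn_compl_subset hΘ.isClosed q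
  have hEA : frontier (connectedComponentIn (G.arc x u ∪ G.arc₂ x y u ∪ G.arc₂ x y' u)ᶜ q) ⊆
      G.arc x y ∪ (G.arc u y ∪ G.arc u y') ∪ G.arc x y' := by
    intro t ht
    rcases hEfr ht with (h | (h | h)) | (h | h)
    · rcases hP t h (frontier_subset_closure ht) with rfl | rfl
      · exact Or.inl (Or.inl (left_mem_arc hxy))
      · exact Or.inl (Or.inr (Or.inl (left_mem_arc huy)))
    all_goals simp [h]
  have hsub := connectedComponentIn_compl_subset (mem_connectedComponentIn hq) hEA
  have hq' : q ∈ (G.arc x y ∪ (G.arc u y ∪ G.arc u y') ∪ G.arc x y')ᶜ := fun h => hq (by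
    simp only [arc₂, mem_union] at h ⊢; tauto)
  have hB : ∀ {b b'}, G.Adj x b → G.Adj u b → G.Adj x b' → G.Adj u b' →
      G.arc x b ∩ (G.arc u b ∪ G.arc u b') = {b} := fun {b b'} hxb hub hxb' hub' => by
    rw [inter_union_distrib_left, G.arc_symm u b, hinter hxb (G.adj_symm _ _ hub) (Adj.ne' hxu)]
    apply union_eq_self_of_subset_right
    rintro z ⟨hz, hz'⟩
    have hu : u ≠ x := (Adj.ne' hxu).symm
    obtain ⟨h1, h2 | h2⟩ := eq_of_mem_arc_of_mem_arc hub' hxb hu (Adj.ne' hub) hz' hz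
    · exact absurd (h2.symm.trans h1) (Adj.ne' hxb')
    · exact h2
  have hxE := closure_mono hsub (mem_closure_connectedComponentIn_of_cycle hxy hxy' hne
    ((isCompact_arc huy).union (isCompact_arc huy'))
    (isPreconnected_compl_union (isCompact_arc huy) (isCompact_arc huy')
      ((arc_inter_arc huy huy' hne).symm ▸ isPreconnected_singleton) (isPreconnected_compl_arc huy)
      (isPreconnected_compl_arc huy')) (hB hxy huy hxy' huy')
    (by rw [union_comm]; exact hB hxy' huy' hxy huy) hq')
  obtain ⟨Φ'', y'', hxy'', huy'', hΦ'', -, hΦd'', ⟨p'', hp'', hpe''⟩, hfr''⟩ :=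
    hx.exists_face hG hext (hΘ.isClosed.isOpen_compl.connectedComponentIn (x := q)) hxE
  have hΦE : Φ'' ⊆ connectedComponentIn (G.arc x u ∪ G.arc₂ x y u ∪ G.arc₂ x y' u)ᶜ q := by
    rw [connectedComponentIn_eq hpe'']
    refine hΦ''.subset_connectedComponentIn hp'' (subset_compl_iff_disjoint_right.2
      (hΦd''.mono_right ?_))
    simp only [arc₂, union_subset_iff]
    exact ⟨⟨arc_subset_drawing hxu, arc_subset_drawing hxy, arc_subset_drawing huy⟩,
      arc_subset_drawing hxy', arc_subset_drawing huy'⟩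
  obtain ⟨z, hz, hzx, hzu⟩ := exists_mem_arc_ne hxu
  rcases hP z hz (closure_mono hΦE (frontier_subset_closure
    (hfr'' ▸ Or.inl (Or.inl hz)))) with h | h
  exacts [hzx h, hzu h]

/-- A point of an arc at a deleted vertex `v` that lies off the remaining drawing is in the same
component as `v`. -/
theorem mem_connectedComponentIn_delete {X : Set (ℝ × ℝ)} {z : ℝ × ℝ} (hv : v ∈ X)
    (h : G.Adj v w) (hz : z ∈ G.arc v w) (hzd : z ∉ (G.delete X).drawing) :
    v ∈ connectedComponentIn (G.delete X).drawingᶜ z := by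
  obtain ⟨γ, hγ, hr⟩ := G.arc_path v w h
  have hz' := hz
  rw [hr] at hz'
  obtain ⟨t, rfl⟩ := hz'
  have hpre : IsPreconnected (γ '' Iic t) :=
    isPreconnected_Iic.image _ γ.continuous.continuousOn
  refine hpre.subset_connectedComponentIn ⟨t, self_mem_Iic, rfl⟩ ?_ ⟨0, t.2.1, γ.source⟩
  rintro _ ⟨s, hs, rfl⟩ hsd
  have hsv : γ s = w → False := fun he => by
    have h1 : s = 1 := hγ (he.trans γ.target.symm)
    have h2 : t = 1 := le_antisymm t.2.2 (h1.ge.trans hs)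
    exact hzd (by rw [h2, ← h1]; exact hsd)
  have hs_arc : γ s ∈ G.arc v w := hr ▸ mem_range_self s
  rcases mem_drawing_iff.1 hsd with hs' | ⟨a, b, hab, hs'⟩
  · rcases mem_of_mem_arc h hs_arc hs'.1 with he | he
    · exact hs'.2 (mem_of_eq_of_mem he hv)
    · exact hsv he
  · have hva : v ≠ a := fun he => hab.2.1 (he ▸ hv)
    have hvb : v ≠ b := fun he => hab.2.2 (he ▸ hv)
    exact hsv (eq_of_mem_arc_of_mem_arc h hab.1 hva hvb hs_arc hs').1

theorem drawing_delete_subset (G : PlaneGraph) (X : Set (ℝ × ℝ)) :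
    (G.delete X).drawing ⊆ G.drawing := by
  intro z hz
  rcases mem_drawing_iff.1 hz with h | ⟨a, b, h, hz⟩
  · exact Or.inl h.1
  · exact arc_subset_drawing h.1 hz

theorem mem_verts_of_mem_drawing (hv : v ∈ G.verts) {X : Set (ℝ × ℝ)}
    (h : v ∈ (G.delete X).drawing) : v ∉ X := by
  rcases mem_drawing_iff.1 h with h | ⟨a, b, h, hz⟩
  · exact h.2
  · rcases mem_of_mem_arc h.1 hz hv with rfl | rfl
    exacts [h.2.1, h.2.2]

end PlaneGraph

open PlaneGraph in
/-- If `u` is a problematic internal vertex of a weak near-triangulation `G` and the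
set `T` of all `u`-bad vertices of `G` is nonempty, then `G − ({u} ∪ T)` is a weak
near-triangulation. -/
theorem WNT_delete_problematic_internal (G : PlaneGraph) (hG : G.IsWNT)
    (u : ℝ × ℝ) (hu : u ∈ G.verts) (hint : ¬ G.ExternalVertex u)
    (hprob : G.Problematic u) (hT : {x | G.IsBadFor u x}.Nonempty) :
    (G.delete ({u} ∪ {x | G.IsBadFor u x})).IsWNT := by
  refine ⟨?_, ?_⟩
  · rintro _ ⟨p, hp, rfl⟩ hFb
    set X := {u} ∪ {x | G.IsBadFor u x} with hX
    have hFfr := frontier_connectedComponentIn_compl_subset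
      (isCompact_drawing (G.delete X)).isClosed p
    have hFo : IsOpen (connectedComponentIn (G.delete X).drawingᶜ p) :=
      (isCompact_drawing (G.delete X)).isClosed.isOpen_compl.connectedComponentIn
    by_cases hd : Disjoint (connectedComponentIn (G.delete X).drawingᶜ p) G.drawing
    · have hpG : p ∉ G.drawing := fun h => hd.le_bot ⟨mem_connectedComponentIn hp, h⟩
      have hF : connectedComponentIn (G.delete X).drawingᶜ p =
          connectedComponentIn G.drawingᶜ p :=
        (isPreconnected_connectedComponentIn.subset_connectedComponentIn
          (mem_connectedComponentIn hp) (subset_compl_iff_disjoint_right.2 hd)).antisymm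
          (connectedComponentIn_mono _ (compl_subset_compl.2 (drawing_delete_subset G X)))
      obtain ⟨a, b, c, h, hfr⟩ := hG.1 _ ⟨p, hpG, hF⟩ hFb
      obtain ⟨ha, hb, hc⟩ := h.mem_triDrawing
      rw [← hfr] at ha hb hc
      have ha := mem_verts_of_mem_drawing (G.adj_mem _ _ h.2.2.2.1) (hFfr ha)
      have hb := mem_verts_of_mem_drawing (adj_mem' h.2.2.2.1) (hFfr hb)
      have hc := mem_verts_of_mem_drawing (adj_mem' h.2.2.2.2.1) (hFfr hc)
      exact ⟨a, b, c, ⟨h.1, h.2.1, h.2.2.1, ⟨h.2.2.2.1, ha, hb⟩, ⟨h.2.2.2.2.1, hb, hc⟩,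
        ⟨h.2.2.2.2.2, ha, hc⟩⟩, hfr⟩
    · exfalso
      obtain ⟨z, hzF, hzG⟩ := not_disjoint_iff.1 hd
      have hzd := connectedComponentIn_subset _ _ hzF
      obtain ⟨v, hvX, hvF⟩ : ∃ v ∈ X, v ∈ connectedComponentIn (G.delete X).drawingᶜ p := by
        rcases mem_drawing_iff.1 hzG with h | ⟨v, w, hvw, hz⟩
        · by_contra! hn
          exact hzd (Or.inl ⟨h, fun hX => hn z hX hzF⟩)
        · rw [connectedComponentIn_eq hzF]
          by_cases hv : v ∈ X
          · exact ⟨v, hv, mem_connectedComponentIn_delete hv hvw hz hzd⟩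
          · by_cases hw : w ∈ X
            · exact ⟨w, hw, mem_connectedComponentIn_delete hw (G.adj_symm _ _ hvw)
                (G.arc_symm v w ▸ hz) hzd⟩
            · exact absurd (arc_subset_drawing (G := G.delete X) ⟨hvw, hv, hw⟩ hz) hzd
      obtain ⟨x, hx, hxF⟩ : ∃ x, G.IsBadFor u x ∧
          x ∈ connectedComponentIn (G.delete X).drawingᶜ p := by
        rcases hvX with rfl | hv
        · obtain ⟨x, hx⟩ := hT
          refine ⟨x, hx, ?_⟩
          rw [connectedComponentIn_eq hvF]
          exact mem_connectedComponentIn_delete (Or.inr hx) (hx.adj hG)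
            (right_mem_arc (hx.adj hG)) (connectedComponentIn_subset _ _ hvF)
        · exact ⟨v, hv, hvF⟩
      obtain ⟨-, _, ⟨q, hq, rfl⟩, hqb, hxq⟩ := hx.externalVertex hG
      obtain ⟨t, htF, htq⟩ := mem_closure_iff.1 hxq _ hFo hxF
      refine hqb (hFb.subset ?_)
      rw [connectedComponentIn_eq htF, connectedComponentIn_eq htq]
      exact connectedComponentIn_mono _ (compl_subset_compl.2 (drawing_delete_subset G X))
  · rintro v ⟨hv, hvX⟩
    simp only [mem_compl_iff, mem_union, mem_singleton_iff, mem_ofPred_eq, not_or] at hvX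
    obtain ⟨b, c, h⟩ : (G.erase u).InTriangle v := by
      by_contra h
      exact hvX.2 ⟨hv, hvX.1, h⟩
    have key : ∀ {a b c}, (G.erase u).IsTriangle a b c → a ∉ {u} ∪ {x | G.IsBadFor u x} := by
      rintro a b c h (h' | h')
      · exact h.2.2.2.1.2.1 h'
      · exact h'.2.2 ⟨b, c, h⟩
    have ha := key h
    have hb := key h.rotate
    have hc := key h.rotate.rotate
    exact ⟨b, c, h.1, h.2.1, h.2.2.1, ⟨h.2.2.2.1.1, ha, hb⟩, ⟨h.2.2.2.2.1.1, hb, hc⟩,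
      ⟨h.2.2.2.2.2.1, ha, hc⟩⟩
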